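/- Let r : ℕ → ℝ be a sequence with |r_k| ≤ B for all k ≥ 1, and let γ ∈ (0,1). Then liminf_{n→∞} (1/n) ∑_{k=1}^n ∑_{i=1}^k r_i γ^{k-i} = (1/(1-γ)) · liminf_{n→∞} (1/n) ∑_{k=1}^n r_k. (The pathwise core of the paper's Tauberian theorem: the average depreciating payoff equals the ordinary average payoff scaled by 1/(1-γ).) -/

import Mathlib

open Filter

lemma aux_rec (r : ℕ → ℝ) (g : ℝ) (k : ℕ) :
    ∑ i ∈ Finset.Icc 1 (k+1), r i * g ^ (k + 1 - i)
      = g * (∑ i ∈ Finset.Icc 1 k, r i * g ^ (k - i)) + r (k+1) := by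
  rw [Finset.sum_Icc_succ_top (by omega), Finset.mul_sum]
  congr 1
  · refine Finset.sum_congr rfl fun i hi => ?_
    have := (Finset.mem_Icc.1 hi).2
    rw [Nat.sub_add_comm this, pow_succ]
    ring
  · simp

lemma aux_sum (r : ℕ → ℝ) (g : ℝ) (n : ℕ) :
    (1 - g) * ∑ k ∈ Finset.Icc 1 n, ∑ i ∈ Finset.Icc 1 k, r i * g ^ (k - i)
      = (∑ k ∈ Finset.Icc 1 n, r k) - g * ∑ i ∈ Finset.Icc 1 n, r i * g ^ (n - i) := by
  induction n with
  | zero => simp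
  | succ n ih =>
    rw [Finset.sum_Icc_succ_top (by omega), Finset.sum_Icc_succ_top (b := n) (f := r) (by omega),
      mul_add, ih, aux_rec]
    ring

lemma aux_bound (r : ℕ → ℝ) (B : ℝ) (hB : ∀ k, 1 ≤ k → |r k| ≤ B)
    (g : ℝ) (hg : g ∈ Set.Ioo (0 : ℝ) 1) (n : ℕ) :
    |∑ i ∈ Finset.Icc 1 n, r i * g ^ (n - i)| ≤ B / (1 - g) := by
  obtain ⟨h0, h1⟩ := hg
  have hB0 : 0 ≤ B := (abs_nonneg _).trans (hB 1 le_rfl)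
  have h2 : 0 < 1 - g := by linarith
  induction n with
  | zero => simpa using div_nonneg hB0 h2.le
  | succ n ih =>
    rw [aux_rec]
    have e : B / (1 - g) = g * (B / (1 - g)) + B := by field_simp; ring
    rw [e]
    refine (abs_add_le _ _).trans (add_le_add ?_ (hB _ (by omega)))
    rw [abs_mul, abs_of_pos h0]
    exact mul_le_mul_of_nonneg_left ih h0.le

lemma aux_le (u v : ℕ → ℝ) (C D : ℝ) (hu : ∀ n, |u n| ≤ C) (hv : ∀ n, |v n| ≤ D)
    (h : Tendsto (fun n => u n - v n) atTop (nhds 0)) :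
    liminf u atTop ≤ liminf v atTop := by
  refine le_of_forall_pos_le_add fun ε hε => ?_
  have h1 : liminf v atTop + ε = liminf (fun n => v n + ε) atTop :=
    Monotone.map_liminf_of_continuousAt (f := fun x : ℝ => x + ε)
      (fun a b hab => by simpa using hab) v (by fun_prop)
      (IsBoundedUnder.isCoboundedUnder_ge ⟨D, by simpa using ⟨0, fun n _ => (abs_le.1 (hv n)).2⟩⟩)
      ⟨-D, by simpa using ⟨0, fun n _ => (abs_le.1 (hv n)).1⟩⟩
  rw [h1]
  refine liminf_le_liminf ?_ ⟨-C, by simpa using ⟨0, fun n _ => (abs_le.1 (hu n)).1⟩⟩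
    (IsBoundedUnder.isCoboundedUnder_ge
      ⟨D + ε, by simpa using ⟨0, fun n _ => (abs_le.1 (hv n)).2⟩⟩)
  filter_upwards [h.eventually (gt_mem_nhds hε)] with n hn
  linarith

/-- pathwise core of the Tauberian theorem: for a bounded reward
sequence `r` (indexed from 1) and `g ∈ (0,1)`, the average depreciating payoff
equals the ordinary average payoff scaled by `1/(1-g)`. -/
theorem liminf_average_depreciating_eq_scaled_liminf_average
    (r : ℕ → ℝ) (B : ℝ) (hB : ∀ k, 1 ≤ k → |r k| ≤ B)
    (g : ℝ) (hg : g ∈ Set.Ioo (0 : ℝ) 1) :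
    Filter.liminf (fun n : ℕ =>
        (1 / (n : ℝ)) * ∑ k ∈ Finset.Icc 1 n, ∑ i ∈ Finset.Icc 1 k, r i * g ^ (k - i))
      atTop
      = (1 / (1 - g)) *
        Filter.liminf (fun n : ℕ => (1 / (n : ℝ)) * ∑ k ∈ Finset.Icc 1 n, r k) atTop := by
  have h2 : 0 < 1 - g := by linarith [hg.2]
  have hB0 : 0 ≤ B := (abs_nonneg _).trans (hB 1 le_rfl)
  have avg : ∀ (f : ℕ → ℝ) (K : ℝ), 0 ≤ K → (∀ k, 1 ≤ k → |f k| ≤ K) → ∀ n : ℕ,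
      |(1 / (n : ℝ)) * ∑ k ∈ Finset.Icc 1 n, f k| ≤ K := by
    intro f K hK hf n
    rcases Nat.eq_zero_or_pos n with rfl | hn
    · simpa using hK
    have hn' : (0 : ℝ) < n := by exact_mod_cast hn
    have : |∑ k ∈ Finset.Icc 1 n, f k| ≤ n * K := by
      refine (Finset.abs_sum_le_sum_abs _ _).trans ?_
      refine (Finset.sum_le_card_nsmul _ _ K fun i hi => hf i (Finset.mem_Icc.1 hi).1).trans ?_
      simp
    rw [abs_mul, abs_of_pos (by positivity), one_div, inv_mul_le_iff₀ hn']
    exact this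
  have hv := avg r B hB0 hB
  have hu := avg _ _ (div_nonneg hB0 h2.le) (fun k _ => aux_bound r B hB g hg k)
  have h1 := Monotone.map_liminf_of_continuousAt (F := atTop) (f := fun x : ℝ => (1 / (1 - g)) * x)
      (fun a b hab => mul_le_mul_of_nonneg_left hab (by positivity))
      (fun n : ℕ => (1 / (n : ℝ)) * ∑ k ∈ Finset.Icc 1 n, r k) (by fun_prop)
      (IsBoundedUnder.isCoboundedUnder_ge
        ⟨B, eventually_map.2 (Eventually.of_forall fun n => (abs_le.1 (hv n)).2)⟩)
      ⟨-B, eventually_map.2 (Eventually.of_forall fun n => (abs_le.1 (hv n)).1)⟩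
  refine Eq.trans ?_ h1.symm
  have hw : ∀ n : ℕ, |((fun x : ℝ => (1 / (1 - g)) * x) ∘
      (fun n : ℕ => (1 / (n : ℝ)) * ∑ k ∈ Finset.Icc 1 n, r k)) n| ≤ 1 / (1 - g) * B := by
    intro n
    simp only [Function.comp]
    rw [abs_mul, abs_of_pos (by positivity : 0 < 1 / (1 - g))]
    exact mul_le_mul_of_nonneg_left (hv n) (by positivity)
  have ht : Tendsto (fun n : ℕ =>
      ((fun x : ℝ => (1 / (1 - g)) * x) ∘
        (fun n : ℕ => (1 / (n : ℝ)) * ∑ k ∈ Finset.Icc 1 n, r k)) n -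
      (1 / (n : ℝ)) * ∑ k ∈ Finset.Icc 1 n, ∑ i ∈ Finset.Icc 1 k, r i * g ^ (k - i))
      atTop (nhds 0) := by
    have hz : Tendsto (fun n : ℕ => (1 / (n : ℝ)) * (g / (1 - g) * (B / (1 - g))))
        atTop (nhds 0) := by
      simpa using (tendsto_one_div_atTop_nhds_zero_nat (𝕜 := ℝ)).mul_const
        (g / (1 - g) * (B / (1 - g)))
    refine squeeze_zero_norm (fun n => ?_) hz
    have hs := aux_sum r g n
    have hb := aux_bound r B hB g hg n
    have e : ((fun x : ℝ => (1 / (1 - g)) * x) ∘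
        (fun n : ℕ => (1 / (n : ℝ)) * ∑ k ∈ Finset.Icc 1 n, r k)) n -
      (1 / (n : ℝ)) * ∑ k ∈ Finset.Icc 1 n, ∑ i ∈ Finset.Icc 1 k, r i * g ^ (k - i)
      = (1 / (n : ℝ)) * (g / (1 - g) * ∑ i ∈ Finset.Icc 1 n, r i * g ^ (n - i)) := by
      have hs' : ∑ k ∈ Finset.Icc 1 n, r k = (1 - g) * (∑ k ∈ Finset.Icc 1 n,
          ∑ i ∈ Finset.Icc 1 k, r i * g ^ (k - i))
          + g * ∑ i ∈ Finset.Icc 1 n, r i * g ^ (n - i) := by linarith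
      simp only [Function.comp]
      rw [hs']
      generalize 1 / (n : ℝ) = t
      field_simp
      ring
    have hg0 := hg.1
    rw [e, Real.norm_eq_abs, abs_mul, abs_mul, abs_of_pos (by positivity : 0 < g / (1 - g)),
      abs_of_nonneg (by positivity : 0 ≤ 1 / (n : ℝ))]
    gcongr
  apply le_antisymm
  · refine aux_le _ _ _ _ hu hw ?_
    simpa using ht.neg
  · exact aux_le _ _ _ _ hw hu ht
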